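/- Let (λ_k)_{k≥1} be a real sequence with λ_1 > 1 and λ_{k+1} > 2 λ_k for all k, and let (μ_m)_{m≥1} be any real sequence. Define the sequence (c_n)_{n≥1} by c_{⟨k,1⟩} = λ_k and c_{⟨k,m⟩} = μ_k for m ≥ 2. Then the set of accumulation points of (c_n) equals the closure of {μ_k : k ∈ ℕ≥1}. -/

import Mathlib

open Filter Metric Topology

noncomputable section

/-- The pairing `⟨k, m⟩ = 2 ^ (k - 1) * (2 * m - 1)`, a bijection `ℕ≥1 × ℕ≥1 → ℕ≥1`. -/
def pairPNat (k m : ℕ+) : ℕ+ :=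
  ⟨2 ^ ((k : ℕ) - 1) * (2 * (m : ℕ) - 1), by
    have hm : 1 ≤ (m : ℕ) := m.one_le
    have h1 : 0 < 2 ^ ((k : ℕ) - 1) := pow_pos (by norm_num) _
    have h2 : 0 < 2 * (m : ℕ) - 1 := by omega
    exact Nat.mul_pos h1 h2⟩

end

noncomputable section

/-- The set of accumulation points of a real sequence indexed by `ℕ≥1`. -/
def accPtsP (a : ℕ+ → ℝ) : Set ℝ :=
  {t | ∃ φ : ℕ → ℕ+, StrictMono φ ∧ Tendsto (a ∘ φ) atTop (𝓝 t)}

theorem exists_pairPNat_eq (n : ℕ+) : ∃ k m : ℕ+, pairPNat k m = n := by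
  obtain ⟨a, b, ⟨j, rfl⟩, h⟩ := Nat.exists_eq_two_pow_mul_odd n.ne_zero
  refine ⟨a.succPNat, j.succPNat, PNat.eq ?_⟩
  simp only [pairPNat, PNat.mk_coe, Nat.succPNat_coe, h]
  congr 1

theorem le_pairPNat_right (k m : ℕ+) : m ≤ pairPNat k m := by
  rw [← PNat.coe_le_coe]
  have hm := m.pos
  calc (m : ℕ) ≤ 1 * (2 * (m : ℕ) - 1) := by omega
    _ ≤ 2 ^ ((k : ℕ) - 1) * (2 * (m : ℕ) - 1) :=
      Nat.mul_le_mul_right _ Nat.one_le_two_pow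

theorem natCast_le_of_two_mul_lt {l : ℕ+ → ℝ} (hl1 : 1 < l 1)
    (hgrow : ∀ k : ℕ+, 2 * l k < l (k + 1)) (k : ℕ+) : ((k : ℕ) : ℝ) ≤ l k := by
  induction k using PNat.recOn with
  | one => simpa using hl1.le
  | succ k ih =>
    have hk : (1 : ℝ) ≤ ((k : ℕ) : ℝ) := by exact_mod_cast k.pos
    have := hgrow k
    push_cast
    linarith

theorem mem_accPtsP_of_frequently {a : ℕ+ → ℝ} {t : ℝ}
    (h : ∀ U ∈ 𝓝 t, ∀ N : ℕ, ∃ n : ℕ+, N < n ∧ a n ∈ U) : t ∈ accPtsP a := by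
  have hc : MapClusterPt t atTop (a ∘ Nat.succPNat) := by
    rw [mapClusterPt_iff_frequently]
    intro U hU
    rw [frequently_atTop]
    intro N
    obtain ⟨n, hn, hnU⟩ := h U hU N
    refine ⟨n.natPred, ?_, by simpa using hnU⟩
    have := n.natPred_add_one
    omega
  obtain ⟨ψ, hψ, hlim⟩ := hc.tendsto_subseq
  exact ⟨Nat.succPNat ∘ ψ, Nat.succPNat_strictMono.comp hψ, hlim⟩

theorem accPts_eq_closure_range
    (l μ : ℕ+ → ℝ) (hl1 : 1 < l 1) (hgrow : ∀ k : ℕ+, 2 * l k < l (k + 1))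
    (c : ℕ+ → ℝ)
    (hc1 : ∀ k : ℕ+, c (pairPNat k 1) = l k)
    (hcm : ∀ k m : ℕ+, 2 ≤ m → c (pairPNat k m) = μ k) :
    accPtsP c = closure (Set.range μ) := by
  apply Set.Subset.antisymm
  · rintro t ⟨φ, hφ, hlim⟩
    rw [mem_closure_iff_nhds]
    intro U hU
    obtain ⟨K, hK⟩ := exists_nat_gt (t + 1)
    have hbound : ∀ᶠ n in atTop, c (φ n) < t + 1 :=
      hlim.eventually_lt_const (lt_add_one t)
    obtain ⟨n, ⟨hnU, hlt⟩, hn⟩ :=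
      ((hlim.eventually_mem hU).and hbound |>.and (eventually_ge_atTop (2 ^ K + 1))).exists
    obtain ⟨k, m, hkm⟩ := exists_pairPNat_eq (φ n)
    by_cases hm : 2 ≤ m
    · refine ⟨μ k, ?_, k, rfl⟩
      rw [← hcm k m hm, hkm]
      exact hnU
    · exfalso
      obtain rfl : m = 1 := by
        rw [not_le, ← PNat.coe_lt_coe] at hm
        apply PNat.eq
        have := m.pos
        change (m : ℕ) < 2 at hm
        change (m : ℕ) = 1
        omega
      rw [← hkm, hc1] at hlt
      have hkK : (k : ℕ) < K := by
        exact_mod_cast (natCast_le_of_two_mul_lt hl1 hgrow k).trans_lt (hlt.trans hK)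
      have hφn : n ≤ (φ n : ℕ) :=
        (show StrictMono fun i => (φ i : ℕ) from fun _ _ h => hφ h).le_apply
      have hval : (φ n : ℕ) = 2 ^ ((k : ℕ) - 1) := by
        rw [← hkm]
        simp [pairPNat]
      have hpow : 2 ^ ((k : ℕ) - 1) ≤ 2 ^ K := Nat.pow_le_pow_right two_pos (by omega)
      omega
  · intro t ht
    refine mem_accPtsP_of_frequently fun U hU N => ?_
    obtain ⟨_, hU', k, rfl⟩ := mem_closure_iff_nhds.mp ht U hU
    have hle := le_pairPNat_right k (N.succPNat + 1)
    rw [← PNat.coe_le_coe, PNat.add_coe, Nat.succPNat_coe] at hle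
    refine ⟨pairPNat k (N.succPNat + 1), by omega, ?_⟩
    rwa [hcm k _ (add_le_add_left one_le 1)]

end
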